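/- Let α ∈ [0,1] and γ be real numbers. Then γ > 4α(1 − √α) if and only if there exist real numbers σ, τ ∈ [0,1] such that \(\tau^2(3-\tau) - 3(1-\alpha)\tau + \sigma^3 - 3\alpha\sigma + 1 + \alpha - \gamma < 0\). -/

import Mathlib

/-- On the nonnegative reals, `x³ - 3s²x` is minimized at `x = s`. -/
lemma neg_two_mul_cube_le {s x : ℝ} (hs : 0 ≤ s) (hx : 0 ≤ x) :
    -2 * s ^ 3 ≤ x ^ 3 - 3 * s ^ 2 * x := by
  have h : 0 ≤ (x - s) ^ 2 * (x + 2 * s) := by positivity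
  linarith [show (x - s) ^ 2 * (x + 2 * s) = x ^ 3 - 3 * s ^ 2 * x + 2 * s ^ 3 by ring]

/-- For `α ∈ [0,1]`, `γ > 4α(1-√α)` iff there exist `σ, τ ∈ [0,1]` with
`τ²(3-τ) - 3(1-α)τ + σ³ - 3ασ + 1 + α - γ < 0`. -/
theorem gifp_bound_characterization (α γ : ℝ) (hα0 : 0 ≤ α) (hα1 : α ≤ 1) :
    γ > 4 * α * (1 - Real.sqrt α) ↔
      ∃ σ τ : ℝ, 0 ≤ σ ∧ σ ≤ 1 ∧ 0 ≤ τ ∧ τ ≤ 1 ∧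
        τ ^ 2 * (3 - τ) - 3 * (1 - α) * τ + σ ^ 3 - 3 * α * σ + 1 + α - γ < 0 := by
  obtain ⟨s, hs⟩ : ∃ s, s = Real.sqrt α := ⟨_, rfl⟩
  have hs0 : 0 ≤ s := hs ▸ Real.sqrt_nonneg α
  have hs1 : s ≤ 1 := hs ▸ Real.sqrt_le_one.mpr hα1
  have hα : α = s ^ 2 := by rw [hs, Real.sq_sqrt hα0]
  rw [← hs, hα]
  constructor
  · intro h
    exact ⟨s, 1 - s, hs0, hs1, by linarith, by linarith, by linarith⟩
  · rintro ⟨σ, τ, hσ0, -, -, hτ1, h⟩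
    have hσ := neg_two_mul_cube_le hs0 hσ0
    have hτ := neg_two_mul_cube_le hs0 (sub_nonneg.mpr hτ1)
    linarith
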